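/- arXiv:2006.02611 — 3 statements merged into one kernel-verified Lean document; each statement's English description precedes it below -/
import Mathlib

section
/- Let d, d', r be positive integers with r ≤ min(d, d'). Let S_U be a nonempty finite subset of {U ∈ ℝ^{d×r} : ‖U‖_S ≤ 1} such that every U in that set-ball is within spectral-norm distance 1/8 of some element of S_U, and let S_V be a nonempty finite subset of {V ∈ ℝ^{d'×r} : ‖V‖_S ≤ 1} with the same (1/8)-net property. Then for every linear map f from ℝ^{d×d'} to a real normed vector space, the supremum of ‖f(M)‖ over all M ∈ ℝ^{d×d'} with ‖M‖_S ≤ 1 and rank(M) ≤ r is at most 2 · max_{U ∈ S_U, V ∈ S_V} ‖f(U Vᵀ)‖. -/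
open Matrix

/-- Spectral norm (largest singular value) of a real matrix, as the operator norm of the
associated linear map between Euclidean spaces. -/
noncomputable def specNorm {m n : Type*} [Fintype m] [Fintype n] [DecidableEq n]
    (A : Matrix m n ℝ) : ℝ :=
  ‖LinearMap.toContinuousLinearMap (Matrix.toEuclideanLin A)‖

open scoped Matrix.Norms.L2Operator

theorem specNorm_eq_l2_opNorm {m n : Type*} [Fintype m] [Fintype n] [DecidableEq n]
    (A : Matrix m n ℝ) : specNorm A = ‖A‖ := rfl

theorem l2_opNorm_transpose {m n : Type*} [Fintype m] [Fintype n] [DecidableEq m] [DecidableEq n]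
    (A : Matrix m n ℝ) : ‖Aᵀ‖ = ‖A‖ := by
  rw [← conjTranspose_eq_transpose_of_trivial, l2_opNorm_conjTranspose]

theorem l2_opNorm_le_one_of_transpose_mul_self {m n : Type*} [Fintype m] [Fintype n]
    [DecidableEq n] {A : Matrix m n ℝ} (h : Aᵀ * A = 1) : ‖A‖ ≤ 1 := by
  have h_sq := l2_opNorm_conjTranspose_mul_self A
  rw [conjTranspose_eq_transpose_of_trivial, h, ← diagonal_one, l2_opNorm_diagonal] at h_sq
  have h_one : ‖(fun _ : n => (1 : ℝ))‖ ≤ 1 := (pi_norm_le_iff_of_nonneg zero_le_one).2 (by simp)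
  nlinarith [norm_nonneg A]

/-- The columns of `W` form an orthonormal basis of the column space of `M`. -/
theorem exists_orthonormal_columns_of_rank {m n : Type*} [Fintype m] [Fintype n]
    [DecidableEq m] [DecidableEq n] (M : Matrix m n ℝ) :
    ∃ W : Matrix m (Fin M.rank) ℝ, Wᵀ * W = 1 ∧ W * (Wᵀ * M) = M := by
  let R := LinearMap.range (toEuclideanLin M)
  have hR : Module.finrank ℝ R = M.rank := (rank_eq_finrank_range_toLin M
    (EuclideanSpace.basisFun m ℝ).toBasis (EuclideanSpace.basisFun n ℝ).toBasis).symm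
  let b : OrthonormalBasis (Fin M.rank) ℝ R := (stdOrthonormalBasis ℝ R).reindex (finCongr hR)
  refine ⟨of fun j i => (b i : EuclideanSpace ℝ m) j, ?_, ?_⟩
  · ext i j
    have h := orthonormal_iff_ite.1 b.orthonormal i j
    rw [Submodule.coe_inner, PiLp.inner_apply] at h
    simp only [RCLike.inner_apply, conj_trivial] at h
    rw [mul_apply, one_apply, ← h]
    exact Finset.sum_congr rfl fun _ _ => mul_comm _ _
  · ext i j
    let x : R := ⟨toEuclideanLin M (EuclideanSpace.single j 1), LinearMap.mem_range_self _ _⟩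
    have hx : ∀ k, (x : EuclideanSpace ℝ m) k = M k j := fun k => by
      simp [x, toLpLin_apply]
    have h := congrArg (fun y : R => (y : EuclideanSpace ℝ m) i) (b.sum_repr' x)
    simp only [Submodule.coe_sum, Submodule.coe_smul, Submodule.coe_inner, PiLp.inner_apply,
      WithLp.ofLp_sum, WithLp.ofLp_smul, Finset.sum_apply, Pi.smul_apply, hx] at h
    simp only [RCLike.inner_apply, conj_trivial, smul_eq_mul] at h
    rw [mul_apply, ← h]
    refine Finset.sum_congr rfl fun k _ => ?_
    rw [mul_comm, mul_apply]
    congr 1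
    exact Finset.sum_congr rfl fun _ _ => mul_comm _ _

/-- A matrix of rank at most `r` in the spectral unit ball factors through `ℝʳ` with both
factors in the spectral unit ball. -/
theorem exists_eq_mul_transpose_of_rank_le {m n : Type*} [Fintype m] [Fintype n]
    [DecidableEq m] [DecidableEq n] {r : ℕ} {M : Matrix m n ℝ} (hM : ‖M‖ ≤ 1) (hr : M.rank ≤ r) :
    ∃ (U : Matrix m (Fin r) ℝ) (V : Matrix n (Fin r) ℝ), ‖U‖ ≤ 1 ∧ ‖V‖ ≤ 1 ∧ M = U * Vᵀ := by
  obtain ⟨W, hW, hWM⟩ := exists_orthonormal_columns_of_rank M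
  let P : Matrix (Fin M.rank) (Fin r) ℝ :=
    (1 : Matrix (Fin r) (Fin r) ℝ).submatrix (Fin.castLE hr) id
  have hP : P * Pᵀ = 1 := by
    ext i j
    simp [P, mul_apply, one_apply]
  have hP_norm : ‖P‖ ≤ 1 := by
    rw [← l2_opNorm_transpose]
    exact l2_opNorm_le_one_of_transpose_mul_self (by rwa [transpose_transpose])
  have hU : ‖W * P‖ ≤ 1 := (l2_opNorm_mul W P).trans
    (mul_le_one₀ (l2_opNorm_le_one_of_transpose_mul_self hW) (norm_nonneg _) hP_norm)
  refine ⟨W * P, Mᵀ * (W * P), hU, (l2_opNorm_mul _ _).trans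
    (mul_le_one₀ (by rwa [l2_opNorm_transpose]) (norm_nonneg _) hU), ?_⟩
  rw [transpose_mul, transpose_mul, transpose_transpose, Matrix.mul_assoc Pᵀ, Matrix.mul_assoc W,
    ← Matrix.mul_assoc P, hP, Matrix.one_mul, hWM]

theorem norm_inv_smul_le_one {E : Type*} [SeminormedAddCommGroup E] [NormedSpace ℝ E] {c : ℝ}
    (hc : 0 < c) {x : E} (hx : ‖x‖ ≤ c) : ‖c⁻¹ • x‖ ≤ 1 := by
  rw [norm_smul, norm_inv, Real.norm_of_nonneg hc.le]
  exact inv_mul_le_one_of_le₀ hx hc.le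

theorem norm_map_mul_transpose_le {F : Type*} [NormedAddCommGroup F] [NormedSpace ℝ F]
    {m n k : Type*} [Fintype m] [Fintype n] [Fintype k] [DecidableEq m] [DecidableEq n]
    [DecidableEq k] (f : Matrix m n ℝ →ₗ[ℝ] F) {B : ℝ}
    (hB : ∀ (U : Matrix m k ℝ) (V : Matrix n k ℝ), ‖U‖ ≤ 1 → ‖V‖ ≤ 1 → ‖f (U * Vᵀ)‖ ≤ B)
    {a b : ℝ} (ha : 0 < a) (hb : 0 < b) {U : Matrix m k ℝ} {V : Matrix n k ℝ}
    (hU : ‖U‖ ≤ a) (hV : ‖V‖ ≤ b) : ‖f (U * Vᵀ)‖ ≤ a * b * B := by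
  have h := hB _ _ (norm_inv_smul_le_one ha hU) (norm_inv_smul_le_one hb hV)
  rw [transpose_smul, Matrix.smul_mul, Matrix.mul_smul, map_smul, map_smul, norm_smul, norm_smul,
    norm_inv, norm_inv, Real.norm_of_nonneg ha.le, Real.norm_of_nonneg hb.le,
    inv_mul_le_iff₀ ha, inv_mul_le_iff₀ hb] at h
  linarith

/-- **Rank-constrained subtraction argument.** Given `(1/8)`-nets `S_U`, `S_V` of the
spectral unit balls of `ℝ^{d×r}` and `ℝ^{d'×r}`, each contained in the corresponding ball,
for every linear map `f` on `d × d'` matrices, the supremum of `‖f M‖` over matrices of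
spectral norm at most 1 and rank at most `r` is at most
`2 · max_{U ∈ S_U, V ∈ S_V} ‖f (U Vᵀ)‖`. -/
theorem rank_constrained_subtraction {F : Type*} [NormedAddCommGroup F] [NormedSpace ℝ F]
    (d d' r : ℕ) (hd : 0 < d) (hd' : 0 < d') (hr : 0 < r) (hrd : r ≤ min d d')
    (S_U : Finset (Matrix (Fin d) (Fin r) ℝ)) (hSU : S_U.Nonempty)
    (S_V : Finset (Matrix (Fin d') (Fin r) ℝ)) (hSV : S_V.Nonempty)
    (hUball : ∀ U ∈ S_U, specNorm U ≤ 1)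
    (hVball : ∀ V ∈ S_V, specNorm V ≤ 1)
    (hUnet : ∀ U : Matrix (Fin d) (Fin r) ℝ, specNorm U ≤ 1 →
      ∃ u ∈ S_U, specNorm (U - u) ≤ 1 / 8)
    (hVnet : ∀ V : Matrix (Fin d') (Fin r) ℝ, specNorm V ≤ 1 →
      ∃ v ∈ S_V, specNorm (V - v) ≤ 1 / 8)
    (f : Matrix (Fin d) (Fin d') ℝ →ₗ[ℝ] F) :
    ∀ M : Matrix (Fin d) (Fin d') ℝ, specNorm M ≤ 1 → M.rank ≤ r →
      ‖f M‖ ≤ 2 * S_U.sup' hSU fun u => S_V.sup' hSV fun v => ‖f (u * vᵀ)‖ := by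
  intro M hM hMr
  simp only [specNorm_eq_l2_opNorm] at hUball hVball hUnet hVnet hM
  set K := S_U.sup' hSU fun u => S_V.sup' hSV fun v => ‖f (u * vᵀ)‖
  have hK : ∀ u ∈ S_U, ∀ v ∈ S_V, ‖f (u * vᵀ)‖ ≤ K := fun u hu v hv =>
    (Finset.le_sup' (fun v => ‖f (u * vᵀ)‖) hv).trans
      (Finset.le_sup' (fun u => S_V.sup' hSV fun v => ‖f (u * vᵀ)‖) hu)
  let T : Set ℝ := {t | ∃ (U : Matrix (Fin d) (Fin r) ℝ) (V : Matrix (Fin d') (Fin r) ℝ),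
    ‖U‖ ≤ 1 ∧ ‖V‖ ≤ 1 ∧ ‖f (U * Vᵀ)‖ = t}
  have hT : BddAbove T := by
    refine ⟨‖LinearMap.toContinuousLinearMap f‖, ?_⟩
    rintro _ ⟨U, V, hU, hV, rfl⟩
    refine (LinearMap.toContinuousLinearMap f).unit_le_opNorm _ ((l2_opNorm_mul _ _).trans ?_)
    exact mul_le_one₀ hU (norm_nonneg _) (by rwa [l2_opNorm_transpose])
  have hB : ∀ (U : Matrix (Fin d) (Fin r) ℝ) (V : Matrix (Fin d') (Fin r) ℝ),
      ‖U‖ ≤ 1 → ‖V‖ ≤ 1 → ‖f (U * Vᵀ)‖ ≤ sSup T :=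
    fun U V hU hV => le_csSup hT ⟨U, V, hU, hV, rfl⟩
  have h_sup : sSup T ≤ K + sSup T / 4 := by
    refine csSup_le ⟨_, 0, 0, by simp, by simp, rfl⟩ ?_
    rintro _ ⟨U, V, hU, hV, rfl⟩
    obtain ⟨u, hu, hUu⟩ := hUnet U hU
    obtain ⟨v, hv, hVv⟩ := hVnet V hV
    have h_split : U * Vᵀ = u * vᵀ + (U - u) * Vᵀ + u * (V - v)ᵀ := by
      rw [transpose_sub, Matrix.sub_mul, Matrix.mul_sub]
      abel
    have h_left := norm_map_mul_transpose_le f hB (by norm_num) one_pos hUu hV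
    have h_right := norm_map_mul_transpose_le f hB one_pos (by norm_num) (hUball u hu) hVv
    have h_tri := norm_add₃_le (a := f (u * vᵀ)) (b := f ((U - u) * Vᵀ)) (c := f (u * (V - v)ᵀ))
    rw [h_split, map_add, map_add]
    linarith [hK u hu v hv]
  obtain ⟨U, V, hU, hV, rfl⟩ := exists_eq_mul_transpose_of_rank_le hM hMr
  linarith [hB U V hU hV, norm_nonneg (f (U * Vᵀ))]
end

section
/- Let J be a positive integer, let d_k, d'_k, r_k (k = 1, …, J) be positive integers with r_k ≤ min(d_k, d'_k), and let ε > 0. Then for each k there exist finite sets S_{U,k} ⊆ {U ∈ ℝ^{d_k×r_k} : ‖U‖_S ≤ 1} with |S_{U,k}| ≤ (1 + 4/ε)^{d_k r_k} and S_{V,k} ⊆ {V ∈ ℝ^{d'_k×r_k} : ‖V‖_S ≤ 1} with |S_{V,k}| ≤ (1 + 4/ε)^{d'_k r_k}, such that for every family of matrices M_k ∈ ℝ^{d_k×d'_k} with ‖M_k‖_S ≤ 1 and rank(M_k) ≤ r_k (k = 1, …, J), there exist U_k ∈ S_{U,k} and V_k ∈ S_{V,k} with ‖⊗_{k=1}^J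 M_k − ⊗_{k=1}^J (U_k V_kᵀ)‖_S ≤ ε·J. -/
open Matrix

/-- The Kronecker product `⊗_{k} M_k` of a finite family of matrices, as a matrix indexed
by tuples, with entry at `((i₁,…,i_J),(j₁,…,j_J))` equal to `∏ k, (M_k)_{i_k, j_k}`. -/
def kronFamily {J : ℕ} {d d' : Fin J → ℕ}
    (M : ∀ k, Matrix (Fin (d k)) (Fin (d' k)) ℝ) :
    Matrix (∀ k, Fin (d k)) (∀ k, Fin (d' k)) ℝ :=
  Matrix.of fun i j => ∏ k, M k (i k) (j k)

open MeasureTheory Metric Module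
open scoped ENNReal Kronecker Matrix.Norms.L2Operator

section Nets

variable {E : Type*} [NormedAddCommGroup E] [NormedSpace ℝ E] [FiniteDimensional ℝ E]

/-- The volumetric bound on the cardinality of a `δ`-separated subset of the unit ball. -/
theorem card_le_of_separated_unit_ball {δ : ℝ} (hδ : 0 < δ) (s : Finset E)
    (hs : ∀ c ∈ s, ‖c‖ ≤ 1) (h : ∀ c ∈ s, ∀ d ∈ s, c ≠ d → δ ≤ ‖c - d‖) :
    (s.card : ℝ) ≤ (1 + 2 / δ) ^ finrank ℝ E := by
  borelize E
  let μ : Measure E := Measure.addHaar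
  have hδ2 : 0 < δ / 2 := half_pos hδ
  have hρ : 0 < 1 + δ / 2 := by positivity
  have hdisj : Set.Pairwise (s : Set E) (Function.onFun Disjoint fun c => ball c (δ / 2)) := by
    intro c hc d hd hcd
    apply ball_disjoint_ball
    rw [dist_eq_norm, add_halves]
    exact h c hc d hd hcd
  have hsub : (⋃ c ∈ s, ball c (δ / 2)) ⊆ ball (0 : E) (1 + δ / 2) := by
    refine Set.iUnion₂_subset fun x hx => ball_subset_ball' ?_
    rw [dist_zero_right]
    linarith [hs x hx]
  have hvol : (s.card : ℝ≥0∞) * ENNReal.ofReal ((δ / 2) ^ finrank ℝ E) * μ (ball 0 1) ≤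
      ENNReal.ofReal ((1 + δ / 2) ^ finrank ℝ E) * μ (ball 0 1) :=
    calc
      _ = μ (⋃ c ∈ s, ball c (δ / 2)) := by
        rw [measure_biUnion_finset hdisj fun c _ => measurableSet_ball]
        simp only [μ.addHaar_ball_of_pos _ hδ2, Finset.sum_const, nsmul_eq_mul, mul_assoc]
      _ ≤ μ (ball (0 : E) (1 + δ / 2)) := measure_mono hsub
      _ = _ := by simp only [μ.addHaar_ball_of_pos _ hρ]
  have hcard := ENNReal.toReal_le_of_le_ofReal (pow_nonneg hρ.le _)
    ((ENNReal.mul_le_mul_iff_left (measure_ball_pos _ _ zero_lt_one).ne'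
      measure_ball_lt_top.ne).1 hvol)
  rw [ENNReal.toReal_mul, ENNReal.toReal_natCast, ENNReal.toReal_ofReal (by positivity),
    ← le_div_iff₀ (by positivity), ← div_pow] at hcard
  have hratio : (1 + δ / 2) / (δ / 2) = 1 + 2 / δ := by
    field_simp
    ring
  rwa [hratio] at hcard

/-- The unit ball of a finite-dimensional normed space has a `δ`-net of cardinality at most
`(1 + 2 / δ) ^ dim`. -/
theorem exists_net_unit_ball {δ : ℝ} (hδ : 0 < δ) :
    ∃ (N : ℕ) (f : Fin N → E), (N : ℝ) ≤ (1 + 2 / δ) ^ finrank ℝ E ∧ (∀ i, ‖f i‖ ≤ 1) ∧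
      ∀ x : E, ‖x‖ ≤ 1 → ∃ i, ‖x - f i‖ ≤ δ := by
  classical
  let S : Set ℕ := {n | ∃ s : Finset E, s.card = n ∧ (∀ c ∈ s, ‖c‖ ≤ 1) ∧
    ∀ c ∈ s, ∀ d ∈ s, c ≠ d → δ ≤ ‖c - d‖}
  have hne : S.Nonempty := ⟨0, ∅, by simp⟩
  have hbdd : BddAbove S := by
    refine ⟨⌊(1 + 2 / δ) ^ finrank ℝ E⌋₊, ?_⟩
    rintro _ ⟨s, rfl, hs, hsep⟩
    exact Nat.le_floor (card_le_of_separated_unit_ball hδ s hs hsep)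
  obtain ⟨s, hcard, hs, hsep⟩ := Nat.sSup_mem hne hbdd
  refine ⟨s.card, fun i => (s.equivFin.symm i : E), card_le_of_separated_unit_ball hδ s hs hsep,
    fun i => hs _ (s.equivFin.symm i).2, fun x hx => ?_⟩
  suffices ∃ c ∈ s, ‖x - c‖ ≤ δ by
    obtain ⟨c, hc, hxc⟩ := this
    exact ⟨s.equivFin ⟨c, hc⟩, by simpa using hxc⟩
  by_contra! hfar
  have hxs : x ∉ s := fun hxs => by simpa using (hfar x hxs).trans' hδ
  have hmem : s.card + 1 ∈ S := by
    refine ⟨insert x s, Finset.card_insert_of_notMem hxs, ?_, ?_⟩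
    · simpa [hx] using hs
    · intro c hc d hd hcd
      rcases Finset.mem_insert.1 hc with rfl | hcs <;>
        rcases Finset.mem_insert.1 hd with rfl | hds
      · exact absurd rfl hcd
      · exact (hfar d hds).le
      · rw [norm_sub_rev]
        exact (hfar c hcs).le
      · exact hsep c hcs d hds hcd
  have := le_csSup hbdd hmem
  omega

end Nets

section SpectralNorm

variable {l m n p : Type*} [Fintype l] [Fintype m] [Fintype n] [Fintype p]

theorem specNorm_eq_norm [DecidableEq n] (A : Matrix m n ℝ) : specNorm A = ‖A‖ := rfl

theorem norm_transpose_l2 [DecidableEq m] [DecidableEq n] (A : Matrix m n ℝ) : ‖Aᵀ‖ = ‖A‖ := by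
  rw [← conjTranspose_eq_transpose_of_trivial, l2_opNorm_conjTranspose]

theorem norm_one_l2_le [DecidableEq n] : ‖(1 : Matrix n n ℝ)‖ ≤ 1 := by
  rw [← diagonal_one, l2_opNorm_diagonal]
  exact (pi_norm_le_iff_of_nonneg zero_le_one).2 fun _ => by simp

theorem norm_le_one_of_transpose_mul_self [DecidableEq n]
    {A : Matrix m n ℝ} (h : Aᵀ * A = 1) : ‖A‖ ≤ 1 := by
  have hA := l2_opNorm_conjTranspose_mul_self A
  rw [conjTranspose_eq_transpose_of_trivial, h] at hA
  nlinarith [norm_one_l2_le (n := n), norm_nonneg A]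

theorem norm_le_of_sum_sq_le [DecidableEq n] {A : Matrix m n ℝ} {c : ℝ} (hc : 0 ≤ c)
    (h : ∀ x : n → ℝ, ∑ i, (A *ᵥ x) i ^ 2 ≤ c ^ 2 * ∑ j, x j ^ 2) : ‖A‖ ≤ c := by
  rw [← specNorm_eq_norm]
  refine ContinuousLinearMap.opNorm_le_bound _ hc fun x => ?_
  refine le_of_sq_le_sq ?_ (by positivity)
  rw [mul_pow, EuclideanSpace.norm_sq_eq, EuclideanSpace.norm_sq_eq]
  simpa using h x.ofLp

theorem sum_sq_mulVec_le [DecidableEq n] (A : Matrix m n ℝ) (x : n → ℝ) :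
    ∑ i, (A *ᵥ x) i ^ 2 ≤ ‖A‖ ^ 2 * ∑ j, x j ^ 2 := by
  have h := pow_le_pow_left₀ (norm_nonneg _) (l2_opNorm_mulVec A (WithLp.toLp 2 x)) 2
  rw [mul_pow, EuclideanSpace.norm_sq_eq, EuclideanSpace.norm_sq_eq] at h
  simpa using h

theorem norm_submatrix_equiv_le [DecidableEq n] [DecidableEq p]
    (A : Matrix m n ℝ) (e : l ≃ m) (f : p ≃ n) :
    ‖A.submatrix e f‖ ≤ ‖A‖ := by
  refine norm_le_of_sum_sq_le (norm_nonneg _) fun x => ?_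
  have h := sum_sq_mulVec_le A (x ∘ f.symm)
  rw [submatrix_mulVec_equiv]
  calc _ = ∑ i, (A *ᵥ (x ∘ f.symm)) i ^ 2 :=
        e.sum_comp fun i => (A *ᵥ (x ∘ f.symm)) i ^ 2
    _ ≤ _ := h
    _ = _ := by
      congr 1
      exact f.symm.sum_comp fun i => x i ^ 2

theorem norm_kronecker_le [DecidableEq m] [DecidableEq p] (A : Matrix l m ℝ) (B : Matrix n p ℝ) :
    ‖A ⊗ₖ B‖ ≤ ‖A‖ * ‖B‖ := by
  refine norm_le_of_sum_sq_le (by positivity) fun x => ?_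
  let y : m → n → ℝ := fun j => B *ᵥ fun q => x (j, q)
  have hy : ∀ i k, ((A ⊗ₖ B) *ᵥ x) (i, k) = (A *ᵥ fun j => y j k) i := by
    intro i k
    simp only [y, mulVec, dotProduct, Fintype.sum_prod_type, kroneckerMap_apply, Finset.mul_sum,
      mul_assoc]
  calc ∑ i, ((A ⊗ₖ B) *ᵥ x) i ^ 2 = ∑ k, ∑ i, (A *ᵥ fun j => y j k) i ^ 2 := by
        simp only [Fintype.sum_prod_type, hy]
        exact Finset.sum_comm
    _ ≤ ∑ k, ‖A‖ ^ 2 * ∑ j, y j k ^ 2 := Finset.sum_le_sum fun k _ => sum_sq_mulVec_le A _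
    _ = ‖A‖ ^ 2 * ∑ j, ∑ k, y j k ^ 2 := by rw [← Finset.mul_sum, Finset.sum_comm]
    _ ≤ ‖A‖ ^ 2 * ∑ j, ‖B‖ ^ 2 * ∑ q, x (j, q) ^ 2 := by
        gcongr with j
        exact sum_sq_mulVec_le B _
    _ = (‖A‖ * ‖B‖) ^ 2 * ∑ j, x j ^ 2 := by
        rw [← Finset.mul_sum, Fintype.sum_prod_type]
        ring

end SpectralNorm

theorem kronFamily_succ {J : ℕ} {d d' : Fin (J + 1) → ℕ}
    (M : ∀ k, Matrix (Fin (d k)) (Fin (d' k)) ℝ) :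
    kronFamily M = (M 0 ⊗ₖ kronFamily fun k => M k.succ).submatrix
      (Fin.consEquiv fun k => Fin (d k)).symm (Fin.consEquiv fun k => Fin (d' k)).symm := by
  ext i j
  simp [kronFamily, Fin.prod_univ_succ, Fin.consEquiv, Fin.tail]

theorem norm_kronFamily_le_one {J : ℕ} {d d' : Fin J → ℕ}
    (M : ∀ k, Matrix (Fin (d k)) (Fin (d' k)) ℝ) (hM : ∀ k, ‖M k‖ ≤ 1) :
    ‖kronFamily M‖ ≤ 1 := by
  induction J with
  | zero =>
    refine norm_le_of_sum_sq_le zero_le_one fun x => ?_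
    simp [kronFamily, mulVec, dotProduct]
  | succ J ih =>
    rw [kronFamily_succ]
    exact (norm_submatrix_equiv_le _ _ _).trans <| (norm_kronecker_le _ _).trans <|
      mul_le_one₀ (hM 0) (norm_nonneg _) (ih _ fun k => hM k.succ)

theorem norm_kronFamily_sub_le {J : ℕ} {d d' : Fin J → ℕ}
    (A B : ∀ k, Matrix (Fin (d k)) (Fin (d' k)) ℝ) (hA : ∀ k, ‖A k‖ ≤ 1) (hB : ∀ k, ‖B k‖ ≤ 1) :
    ‖kronFamily A - kronFamily B‖ ≤ ∑ k, ‖A k - B k‖ := by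
  induction J with
  | zero =>
    have h : kronFamily A = kronFamily B := by
      ext i j
      simp [kronFamily]
    simp [h]
  | succ J ih =>
    set A' := kronFamily fun k => A k.succ
    set B' := kronFamily fun k => B k.succ
    have hsplit : A 0 ⊗ₖ A' - B 0 ⊗ₖ B' = (A 0 - B 0) ⊗ₖ A' + B 0 ⊗ₖ (A' - B') := by
      ext i j
      simp only [Matrix.sub_apply, Matrix.add_apply, kroneckerMap_apply]
      ring
    have hA' : ‖A'‖ ≤ 1 := norm_kronFamily_le_one _ fun k => hA k.succ
    rw [kronFamily_succ, kronFamily_succ, Fin.sum_univ_succ]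
    calc _ ≤ ‖A 0 ⊗ₖ A' - B 0 ⊗ₖ B'‖ := norm_submatrix_equiv_le (A 0 ⊗ₖ A' - B 0 ⊗ₖ B') _ _
      _ ≤ ‖(A 0 - B 0) ⊗ₖ A'‖ + ‖B 0 ⊗ₖ (A' - B')‖ := hsplit ▸ norm_add_le _ _
      _ ≤ ‖A 0 - B 0‖ * ‖A'‖ + ‖B 0‖ * ‖A' - B'‖ :=
        add_le_add (norm_kronecker_le _ _) (norm_kronecker_le _ _)
      _ ≤ ‖A 0 - B 0‖ + ∑ k : Fin J, ‖A k.succ - B k.succ‖ :=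
        add_le_add (mul_le_of_le_one_right (norm_nonneg _) hA')
          ((mul_le_of_le_one_left (norm_nonneg _) (hB 0)).trans
            (ih _ _ (fun k => hA k.succ) fun k => hB k.succ))

/-- A contraction of rank at most `r` is a product `U * Vᵀ` of contractions with `r` columns. -/
theorem exists_factorization_of_rank_le {m n r : ℕ} (M : Matrix (Fin m) (Fin n) ℝ)
    (hM : ‖M‖ ≤ 1) (hr : M.rank ≤ r) :
    ∃ (U : Matrix (Fin m) (Fin r) ℝ) (V : Matrix (Fin n) (Fin r) ℝ),
      ‖U‖ ≤ 1 ∧ ‖V‖ ≤ 1 ∧ M = U * Vᵀ := by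
  let W : Submodule ℝ (EuclideanSpace ℝ (Fin m)) := LinearMap.range (toEuclideanLin M)
  have hW : finrank ℝ W ≤ r := by
    rwa [M.rank_eq_finrank_range_toLin (PiLp.basisFun 2 ℝ (Fin m)) (PiLp.basisFun 2 ℝ (Fin n)),
      ← toLpLin_eq_toLin] at hr
  let b := stdOrthonormalBasis ℝ W
  let U : Matrix (Fin m) (Fin (finrank ℝ W)) ℝ := of fun i j => (b j : EuclideanSpace ℝ (Fin m)) i
  let P : Matrix (Fin (finrank ℝ W)) (Fin r) ℝ := of fun i j => if Fin.castLE hW i = j then 1 else 0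
  have hU : ‖U‖ ≤ 1 := by
    apply norm_le_one_of_transpose_mul_self
    ext i j
    have h := orthonormal_iff_ite.1 b.orthonormal i j
    rw [Submodule.coe_inner, PiLp.inner_apply] at h
    rw [one_apply, ← h, mul_apply]
    exact Finset.sum_congr rfl fun k _ => mul_comm _ _
  have hP : P * Pᵀ = 1 := by
    ext i j
    simp [P, mul_apply, one_apply]
  have hPn : ‖P‖ ≤ 1 := by
    rw [← norm_transpose_l2]
    exact norm_le_one_of_transpose_mul_self (by rwa [transpose_transpose])
  have hproj : U * (Uᵀ * M) = M := by
    ext i j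
    let y : W := ⟨toEuclideanLin M (EuclideanSpace.single j 1), LinearMap.mem_range_self _ _⟩
    have hy : ∀ i, (y : EuclideanSpace ℝ (Fin m)) i = M i j := by
      intro i
      simp [y]
    have h := congrArg (fun z : W => (z : EuclideanSpace ℝ (Fin m)) i) (b.sum_repr' y)
    simp only [hy, Submodule.coe_sum, Submodule.coe_smul, Submodule.coe_inner,
      PiLp.inner_apply] at h
    rw [← h]
    simp [U, mul_apply, mul_comm (M _ _), mul_comm _ ((b _ : EuclideanSpace ℝ (Fin m)) i)]
  refine ⟨U * P, Mᵀ * U * P, ?_, ?_, ?_⟩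
  · exact (l2_opNorm_mul _ _).trans (mul_le_one₀ hU (norm_nonneg _) hPn)
  · refine (l2_opNorm_mul _ _).trans (mul_le_one₀ ?_ (norm_nonneg _) hPn)
    exact (l2_opNorm_mul _ _).trans
      (mul_le_one₀ ((norm_transpose_l2 M).trans_le hM) (norm_nonneg _) hU)
  · rw [transpose_mul, transpose_mul, transpose_transpose, Matrix.mul_assoc U P,
      ← Matrix.mul_assoc P, hP, Matrix.one_mul, hproj]

theorem norm_mul_transpose_le_one {m n r : ℕ} {U : Matrix (Fin m) (Fin r) ℝ}
    {V : Matrix (Fin n) (Fin r) ℝ} (hU : ‖U‖ ≤ 1) (hV : ‖V‖ ≤ 1) : ‖U * Vᵀ‖ ≤ 1 :=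
  (l2_opNorm_mul _ _).trans
    (mul_le_one₀ hU (norm_nonneg _) ((norm_transpose_l2 V).trans_le hV))

theorem norm_mul_transpose_sub_le {m n r : ℕ} {U U₀ : Matrix (Fin m) (Fin r) ℝ}
    {V V₀ : Matrix (Fin n) (Fin r) ℝ} (hV : ‖V‖ ≤ 1) (hU₀ : ‖U₀‖ ≤ 1) :
    ‖U * Vᵀ - U₀ * V₀ᵀ‖ ≤ ‖U - U₀‖ + ‖V - V₀‖ := by
  have hsplit : U * Vᵀ - U₀ * V₀ᵀ = (U - U₀) * Vᵀ + U₀ * (V - V₀)ᵀ := by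
    rw [transpose_sub, Matrix.sub_mul, Matrix.mul_sub]
    abel
  rw [hsplit]
  refine (norm_add_le _ _).trans (add_le_add ?_ ?_)
  · refine (l2_opNorm_mul _ _).trans (mul_le_of_le_one_right (norm_nonneg _) ?_)
    rwa [norm_transpose_l2]
  · refine (l2_opNorm_mul _ _).trans ?_
    rw [norm_transpose_l2]
    exact mul_le_of_le_one_left (norm_nonneg _) hU₀

/-- The spectral unit ball of `m × n` matrices has an `ε / 2`-net of cardinality at most
`(1 + 4 / ε) ^ (m * n)`. -/
theorem exists_matrix_net (m n : ℕ) {ε : ℝ} (hε : 0 < ε) :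
    ∃ (N : ℕ) (f : Fin N → Matrix (Fin m) (Fin n) ℝ), (N : ℝ) ≤ (1 + 4 / ε) ^ (m * n) ∧
      (∀ i, ‖f i‖ ≤ 1) ∧ ∀ A : Matrix (Fin m) (Fin n) ℝ, ‖A‖ ≤ 1 → ∃ i, ‖A - f i‖ ≤ ε / 2 := by
  obtain ⟨N, f, hN, hf⟩ := exists_net_unit_ball (E := Matrix (Fin m) (Fin n) ℝ) (half_pos hε)
  refine ⟨N, f, ?_, hf⟩
  have h : 2 / (ε / 2) = 4 / ε := by
    field_simp
    norm_num
  simpa [finrank_matrix, h] using hN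

/-- **Covering claim of Lemma (iii).** There are nets of the factor spectral unit balls, of
cardinalities at most `(1+4/ε)^{d_k r_k}` and `(1+4/ε)^{d'_k r_k}`, such that every Kronecker
product of rank-constrained matrices in the spectral unit balls is within spectral distance
`ε·J` of a Kronecker product of products `U_k V_kᵀ` of net elements. -/
theorem kron_low_rank_net {J : ℕ} (hJ : 0 < J) (d d' r : Fin J → ℕ)
    (hd : ∀ k, 0 < d k) (hd' : ∀ k, 0 < d' k) (hr : ∀ k, 0 < r k)
    (hrd : ∀ k, r k ≤ min (d k) (d' k)) (ε : ℝ) (hε : 0 < ε) :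
    ∃ (N N' : Fin J → ℕ)
      (U : ∀ k, Fin (N k) → Matrix (Fin (d k)) (Fin (r k)) ℝ)
      (V : ∀ k, Fin (N' k) → Matrix (Fin (d' k)) (Fin (r k)) ℝ),
      (∀ k, (N k : ℝ) ≤ (1 + 4 / ε) ^ (d k * r k)) ∧
      (∀ k, (N' k : ℝ) ≤ (1 + 4 / ε) ^ (d' k * r k)) ∧
      (∀ k j, specNorm (U k j) ≤ 1) ∧
      (∀ k j', specNorm (V k j') ≤ 1) ∧
      (∀ M : ∀ k, Matrix (Fin (d k)) (Fin (d' k)) ℝ,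
        (∀ k, specNorm (M k) ≤ 1) → (∀ k, (M k).rank ≤ r k) →
        ∃ (j : ∀ k, Fin (N k)) (j' : ∀ k, Fin (N' k)),
          specNorm (kronFamily M - kronFamily (fun k => U k (j k) * (V k (j' k))ᵀ)) ≤
            ε * J) := by
  choose N U hN hU hUnet using fun k => exists_matrix_net (d k) (r k) hε
  choose N' V hN' hV hVnet using fun k => exists_matrix_net (d' k) (r k) hε
  refine ⟨N, N', U, V, hN, hN', hU, hV, fun M hM hrank => ?_⟩
  choose A B hA hB hAB using fun k => exists_factorization_of_rank_le (M k) (hM k) (hrank k)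
  choose j hj using fun k => hUnet k (A k) (hA k)
  choose j' hj' using fun k => hVnet k (B k) (hB k)
  refine ⟨j, j', ?_⟩
  rw [specNorm_eq_norm]
  calc _ ≤ ∑ k, ‖M k - U k (j k) * (V k (j' k))ᵀ‖ :=
        norm_kronFamily_sub_le _ _ hM fun k => norm_mul_transpose_le_one (hU k _) (hV k _)
    _ ≤ ∑ _k : Fin J, ε := Finset.sum_le_sum fun k _ => by
        rw [hAB k]
        refine (norm_mul_transpose_sub_le (hB k) (hU k _)).trans ?_
        linarith [hj k, hj' k]
    _ = ε * J := by simp [mul_comm]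
end

section
/- Let J be a positive integer, let d_k, d'_k, r_k (k = 1, …, J) be positive integers with r_k < min(d_k, d'_k), let ε > 0, and let f be a linear map from the space of (∏_k d_k) × (∏_k d'_k) real matrices to a real normed vector space. Suppose M_k, M̃_k ∈ ℝ^{d_k×d'_k} satisfy ‖M_k‖_S ≤ 1, ‖M̃_k‖_S ≤ 1, rank(M_k) ≤ r_k, rank(M̃_k) ≤ r_k, and ‖M_k − M̃_k‖_S ≤ ε for every k. Then ‖f(⊗_{k=1}^J M_k − ⊗_{k=1}^J M̃_k)‖ ≤ 2Jε · sup{‖f(⊗_{k=1}^J N_k)‖ : N_k ∈ ℝ^{d_k×d'_k}, ‖N_k‖_S ≤ 1, rank(N_k) ≤ r_k for all k}. -/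
open Matrix

theorem rank_eq_finrank_range_toEuclideanLin {m n : Type*} [Fintype m] [Fintype n]
    [DecidableEq m] [DecidableEq n] (A : Matrix m n ℝ) :
    A.rank = Module.finrank ℝ (LinearMap.range (toEuclideanLin A)) := by
  rw [Matrix.toEuclideanLin, Matrix.toLpLin_eq_toLin]
  exact A.rank_eq_finrank_range_toLin _ _

theorem specNorm_smul {m n : Type*} [Fintype m] [Fintype n] [DecidableEq n]
    (c : ℝ) (A : Matrix m n ℝ) : specNorm (c • A) = |c| * specNorm A := by
  simp [specNorm, norm_smul]

theorem abs_entry_le_specNorm {m n : Type*} [Fintype m] [Fintype n] [DecidableEq n]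
    (A : Matrix m n ℝ) (i : m) (j : n) : |A i j| ≤ specNorm A := by
  have h := (LinearMap.toContinuousLinearMap (toEuclideanLin A)).le_opNorm
    (EuclideanSpace.single j 1)
  have h' := (PiLp.norm_apply_le (toEuclideanLin A (EuclideanSpace.single j 1)) i).trans h
  simpa [specNorm, Matrix.toLpLin_apply] using h'

/-- A difference of two matrices of rank at most `r` is a sum of two matrices of rank at most `r`
whose spectral norms do not exceed that of the difference: split it along the orthogonal
projection onto the range of the first matrix. -/
theorem exists_add_eq_sub_of_rank_le {m n : Type*} [Fintype m] [Fintype n]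
    [DecidableEq m] [DecidableEq n] {A B : Matrix m n ℝ} {r : ℕ}
    (hA : A.rank ≤ r) (hB : B.rank ≤ r) :
    ∃ C D : Matrix m n ℝ, A - B = C + D ∧
      specNorm C ≤ specNorm (A - B) ∧ C.rank ≤ r ∧
      specNorm D ≤ specNorm (A - B) ∧ D.rank ≤ r := by
  rw [rank_eq_finrank_range_toEuclideanLin] at hA hB
  set U := LinearMap.range (toEuclideanLin A) with hU
  have specNorm_comp_le : ∀ P : EuclideanSpace ℝ m →L[ℝ] EuclideanSpace ℝ m, ‖P‖ ≤ 1 →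
      specNorm (toEuclideanLin.symm (P.toLinearMap ∘ₗ toEuclideanLin (A - B)))
        ≤ specNorm (A - B) := by
    intro P hP
    rw [specNorm, LinearEquiv.apply_symm_apply]
    calc _ = ‖P.comp (LinearMap.toContinuousLinearMap (toEuclideanLin (A - B)))‖ := rfl
      _ ≤ ‖P‖ * specNorm (A - B) := ContinuousLinearMap.opNorm_comp_le _ _
      _ ≤ specNorm (A - B) := mul_le_of_le_one_left (norm_nonneg _) hP
  refine ⟨toEuclideanLin.symm (U.starProjection.toLinearMap ∘ₗ toEuclideanLin (A - B)),
    toEuclideanLin.symm (Uᗮ.starProjection.toLinearMap ∘ₗ toEuclideanLin (A - B)), ?_,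
    specNorm_comp_le _ U.starProjection_norm_le, ?_,
    specNorm_comp_le _ Uᗮ.starProjection_norm_le, ?_⟩
  · rw [← map_add, LinearEquiv.eq_symm_apply]
    ext1 x
    simp [-map_sub, -LinearMap.sub_apply]
  · rw [rank_eq_finrank_range_toEuclideanLin, LinearEquiv.apply_symm_apply]
    refine (Submodule.finrank_mono ?_).trans hA
    rintro _ ⟨x, rfl⟩
    exact U.starProjection_apply_mem _
  · rw [rank_eq_finrank_range_toEuclideanLin, LinearEquiv.apply_symm_apply]
    have key : Uᗮ.starProjection.toLinearMap ∘ₗ toEuclideanLin (A - B)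
        = -(Uᗮ.starProjection.toLinearMap ∘ₗ toEuclideanLin B) := by
      ext1 x
      have hx : Uᗮ.starProjection (toEuclideanLin A x) = 0 := by
        rw [Submodule.starProjection_apply_eq_zero_iff, Submodule.orthogonal_orthogonal]
        exact ⟨x, rfl⟩
      simp only [LinearMap.comp_apply, map_sub, LinearMap.sub_apply, LinearMap.neg_apply,
        ContinuousLinearMap.coe_coe, hx, zero_sub]
    rw [key, LinearMap.range_neg, LinearMap.range_comp]
    exact (Submodule.finrank_map_le _ _).trans hB

/-- `kronFamily` as a multilinear map. -/
def kronFamilyMultilinear {J : ℕ} (d d' : Fin J → ℕ) :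
    MultilinearMap ℝ (fun k => Matrix (Fin (d k)) (Fin (d' k)) ℝ)
      (Matrix (∀ k, Fin (d k)) (∀ k, Fin (d' k)) ℝ) :=
  MultilinearMap.pi fun i => MultilinearMap.pi fun j =>
    (MultilinearMap.mkPiAlgebra ℝ (Fin J) ℝ).compLinearMap
      fun k => Matrix.entryLinearMap ℝ ℝ (i k) (j k)

theorem kronFamilyMultilinear_apply {J : ℕ} {d d' : Fin J → ℕ}
    (M : ∀ k, Matrix (Fin (d k)) (Fin (d' k)) ℝ) :
    kronFamilyMultilinear d d' M = kronFamily M := by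
  ext i j
  change MultilinearMap.mkPiAlgebra ℝ (Fin J) ℝ _ = _
  simp [kronFamily]

theorem norm_map_kronFamily_le_sum {F : Type*} [NormedAddCommGroup F]
    [NormedSpace ℝ F] {J : ℕ} {d d' : Fin J → ℕ}
    (f : Matrix (∀ k, Fin (d k)) (∀ k, Fin (d' k)) ℝ →ₗ[ℝ] F)
    {N : ∀ k, Matrix (Fin (d k)) (Fin (d' k)) ℝ} (hN : ∀ k, specNorm (N k) ≤ 1) :
    ‖f (kronFamily N)‖ ≤ ∑ i, ∑ j, ‖f (Matrix.single i j 1)‖ := by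
  rw [matrix_eq_sum_single (kronFamily N)]
  simp only [map_sum]
  refine norm_sum_le_of_le _ fun i _ => norm_sum_le_of_le _ fun j _ => ?_
  rw [← mul_one (kronFamily N i j), ← smul_eq_mul, ← Matrix.smul_single, map_smul, norm_smul]
  refine mul_le_of_le_one_left (norm_nonneg _) ?_
  rw [Real.norm_eq_abs, kronFamily, Matrix.of_apply, Finset.abs_prod]
  exact Finset.prod_le_one (fun _ _ => abs_nonneg _)
    fun k _ => (abs_entry_le_specNorm _ _ _).trans (hN k)

/-- **Inequality (lm-3-3) of Lemma (iii).** If `M_k, M̃_k` are rank-constrained matrices in the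
spectral unit balls with `‖M_k − M̃_k‖_S ≤ ε` for every `k`, then for any linear map `f`,
`‖f (⊗_k M_k − ⊗_k M̃_k)‖ ≤ 2Jε · sup {‖f (⊗_k N_k)‖ : ‖N_k‖_S ≤ 1, rank N_k ≤ r_k ∀k}`. -/
theorem kron_low_rank_difference_bound {F : Type*} [NormedAddCommGroup F]
    [NormedSpace ℝ F] {J : ℕ} (hJ : 0 < J) (d d' r : Fin J → ℕ)
    (hd : ∀ k, 0 < d k) (hd' : ∀ k, 0 < d' k) (hr : ∀ k, 0 < r k)
    (hrd : ∀ k, r k < min (d k) (d' k)) (ε : ℝ) (hε : 0 < ε)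
    (f : Matrix (∀ k, Fin (d k)) (∀ k, Fin (d' k)) ℝ →ₗ[ℝ] F)
    (M Mt : ∀ k, Matrix (Fin (d k)) (Fin (d' k)) ℝ)
    (hM : ∀ k, specNorm (M k) ≤ 1) (hMt : ∀ k, specNorm (Mt k) ≤ 1)
    (hMr : ∀ k, (M k).rank ≤ r k) (hMtr : ∀ k, (Mt k).rank ≤ r k)
    (hdiff : ∀ k, specNorm (M k - Mt k) ≤ ε) :
    ‖f (kronFamily M - kronFamily Mt)‖ ≤ 2 * J * ε *
      sSup ((fun N : ∀ k, Matrix (Fin (d k)) (Fin (d' k)) ℝ => ‖f (kronFamily N)‖) ''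
        {N | ∀ k, specNorm (N k) ≤ 1 ∧ (N k).rank ≤ r k}) := by
  set T : Set (∀ k, Matrix (Fin (d k)) (Fin (d' k)) ℝ) :=
    {N | ∀ k, specNorm (N k) ≤ 1 ∧ (N k).rank ≤ r k} with hT
  set S := sSup ((fun N : ∀ k, Matrix (Fin (d k)) (Fin (d' k)) ℝ => ‖f (kronFamily N)‖) '' T)
    with hS
  set g := f.compMultilinearMap (kronFamilyMultilinear d d') with hg
  have g_apply : ∀ N, g N = f (kronFamily N) := fun N => by
    simp [hg, kronFamilyMultilinear_apply]
  have norm_le_sSup : ∀ N ∈ T, ‖g N‖ ≤ S := fun N hN => by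
    rw [g_apply]
    refine le_csSup ⟨∑ i, ∑ j, ‖f (Matrix.single i j 1)‖, ?_⟩ ⟨N, hN, rfl⟩
    rintro _ ⟨N', hN', rfl⟩
    exact norm_map_kronFamily_le_sum f fun k => (hN' k).1
  have norm_update_le : ∀ N ∈ T, ∀ k, ∀ C : Matrix (Fin (d k)) (Fin (d' k)) ℝ,
      specNorm C ≤ ε → C.rank ≤ r k → ‖g (Function.update N k C)‖ ≤ ε * S := by
    intro N hN k C hC hCr
    have hmem : Function.update N k (ε⁻¹ • C) ∈ T := by
      intro l
      rcases eq_or_ne l k with rfl | hl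
      · rw [Function.update_self, specNorm_smul, abs_of_pos (inv_pos.2 hε)]
        refine ⟨(inv_mul_le_one₀ hε).2 hC, ?_⟩
        rwa [Matrix.rank_smul_of_mem_nonZeroDivisors C
          (mem_nonZeroDivisors_of_ne_zero (inv_ne_zero hε.ne'))]
      · rw [Function.update_of_ne hl]
        exact hN l
    have hC_eq : C = ε • ε⁻¹ • C := (smul_inv_smul₀ hε.ne' C).symm
    rw [hC_eq, MultilinearMap.map_update_smul, norm_smul, Real.norm_of_nonneg hε.le]
    exact mul_le_mul_of_nonneg_left (norm_le_sSup _ hmem) hε.le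
  have telescope : ∀ s : Finset (Fin J),
      ‖g M - g (s.piecewise Mt M)‖ ≤ 2 * s.card * ε * S := by
    intro s
    induction s using Finset.induction_on with
    | empty => simp
    | insert k s hk ih =>
      set N := s.piecewise Mt M with hN
      have hNT : N ∈ T := fun l => by
        by_cases hl : l ∈ s
        · simpa [hN, hl] using ⟨hMt l, hMtr l⟩
        · simpa [hN, hl] using ⟨hM l, hMr l⟩
      have hNk : g N = g (Function.update N k (M k)) := by
        rw [← Finset.piecewise_eq_of_notMem s Mt M hk, Function.update_eq_self]
      obtain ⟨C, D, hCD, hC, hCr, hD, hDr⟩ := exists_add_eq_sub_of_rank_le (hMr k) (hMtr k)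
      have step : ‖g N - g (Function.update N k (Mt k))‖ ≤ ε * S + ε * S := by
        rw [hNk, ← MultilinearMap.map_update_sub, hCD, MultilinearMap.map_update_add]
        exact norm_add_le_of_le (norm_update_le N hNT k C (hC.trans (hdiff k)) hCr)
          (norm_update_le N hNT k D (hD.trans (hdiff k)) hDr)
      rw [Finset.piecewise_insert, Finset.card_insert_of_notMem hk]
      calc _ ≤ 2 * s.card * ε * S + (ε * S + ε * S) :=
            norm_sub_le_norm_sub_add_norm_sub _ (g N) _ |>.trans (add_le_add ih step)
        _ = _ := by push_cast; ring
  simpa [g_apply] using telescope Finset.univ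
end
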